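/- arXiv:1704.05314 — 2 statements merged into one kernel-verified Lean document; each statement's English description precedes it below -/
import Mathlib

section
/- Let n ≥ 1, x₀ ∈ ℝⁿ, R > 0, T > 0, ρ > 0, and let ϑ ⊆ ℝⁿ be open with ϑ ⊆ B(x₀,R). Let p : ℝ → ℝ be C¹ with 0 < p₁ ≤ p(t) ≤ p₂ and |p′(t)| ≤ M on [0,T]. Define φ(x,t) := −|x − x₀|²/(4p(T)(T − t + ρ)) − (n/2) ln(T − t + ρ). Let z : ℝⁿ × ℝ → ℝ be C^∞ with supp z(·,t) contained in a fixed compact K ⊆ ϑ for all t ∈ [0,T]; set w := ∂ₜz − p(t)Δz, y(t) := ∫_ϑ z² e^{φ} dx, assume y > 0 on [0,T], and set N(t) := p(t) ∫_ϑ |∇z|² e^{φ} dx / y(t). Then for every t ∈ (0,T): | y′(t) + 2N(t)y(t) | ≤ ( C₀/(T − t + ρ) + C₁ ) y(t) + 2 ∫_ϑ |w z| e^{φ} dx, where C₀ := M R²/(2p₁²) and C₁ := (2+n) M/p₁. -/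
open MeasureTheory

/-- The Laplacian of `f : ℝⁿ → ℝ` at `x`, as the trace of the second derivative. -/
noncomputable def lapl {n : ℕ} (f : EuclideanSpace ℝ (Fin n) → ℝ)
    (x : EuclideanSpace ℝ (Fin n)) : ℝ :=
  ∑ i : Fin n, iteratedFDeriv ℝ 2 f x ![EuclideanSpace.single i 1, EuclideanSpace.single i 1]

/-- The integral of a directional derivative of a compactly supported `C¹` function vanishes. -/
lemma integral_fderiv_apply_eq_zero_of_hasCompactSupport {E : Type*} [NormedAddCommGroup E]
    [NormedSpace ℝ E] [FiniteDimensional ℝ E] [MeasurableSpace E] [BorelSpace E]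
    (μ : Measure E) [Measure.IsAddHaarMeasure μ] {f : E → ℝ} (hf : ContDiff ℝ 1 f)
    (hc : HasCompactSupport f) (v : E) : ∫ x, fderiv ℝ f x v ∂μ = 0 := by
  have hi : Integrable (fun x => fderiv ℝ f x v) μ :=
    ((hf.continuous_fderiv one_ne_zero).clm_apply continuous_const).integrable_of_hasCompactSupport
      (hc.fderiv_apply ℝ v)
  have hif : Integrable f μ := hf.continuous.integrable_of_hasCompactSupport hc
  have := integral_mul_fderiv_eq_neg_fderiv_mul_of_integrable (μ := μ) (𝕜 := ℝ)
    (f := fun _ : E => (1 : ℝ)) (g := f) (v := v) (by simp) (by simpa using hi) (by simpa using hif)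
    (fun x _ => differentiableAt_const _) (fun x _ => (hf.differentiable one_ne_zero) x)
  simpa using this

/-- Differentiation under the integral sign over a compact set. -/
lemma IsCompact.hasDerivAt_setIntegral {E : Type*} [TopologicalSpace E] [T2Space E]
    [MeasurableSpace E] [BorelSpace E] {μ : Measure E} [IsFiniteMeasureOnCompacts μ]
    {K : Set E} (hK : IsCompact K) {F F' : ℝ → E → ℝ} {a b t : ℝ} (ht : t ∈ Set.Ioo a b)
    (hF : ∀ s ∈ Set.Icc a b, ContinuousOn (F s) K)
    (hF' : ContinuousOn (fun q : ℝ × E => F' q.1 q.2) (Set.Icc a b ×ˢ K))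
    (hd : ∀ x ∈ K, ∀ s ∈ Set.Icc a b, HasDerivAt (fun s => F s x) (F' s x) s) :
    HasDerivAt (fun s => ∫ x in K, F s x ∂μ) (∫ x in K, F' t x ∂μ) t := by
  obtain ⟨C, hC⟩ := (isCompact_Icc.prod hK).exists_bound_of_continuousOn hF'
  have hnhds : Set.Icc a b ∈ nhds t := Icc_mem_nhds ht.1 ht.2
  have htI : t ∈ Set.Icc a b := Set.Ioo_subset_Icc_self ht
  have hcF' : ContinuousOn (F' t) K :=
    hF'.comp (f := fun x => (t, x)) (by fun_prop) (fun x hx => ⟨htI, hx⟩)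
  refine (hasDerivAt_integral_of_dominated_loc_of_deriv_le (bound := fun _ => C) hnhds
    ?_ ((hF t htI).integrableOn_compact hK) (hcF'.integrableOn_compact hK).1 ?_ ?_ ?_).2
  · filter_upwards [hnhds] with s hs using ((hF s hs).integrableOn_compact hK).1
  · exact ae_restrict_of_forall_mem hK.measurableSet fun x hx s hs => hC (s, x) ⟨hs, hx⟩
  · exact integrableOn_const hK.measure_lt_top.ne
  · exact ae_restrict_of_forall_mem hK.measurableSet fun x hx s hs => hd x hx s hs

lemma norm_gradient_sq_eq_sum {n : ℕ} (f : EuclideanSpace ℝ (Fin n) → ℝ)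
    (x : EuclideanSpace ℝ (Fin n)) :
    ‖gradient f x‖ ^ 2 = ∑ i, (fderiv ℝ f x (EuclideanSpace.single i 1)) ^ 2 := by
  rw [EuclideanSpace.real_norm_sq_eq]
  refine Finset.sum_congr rfl fun i _ => ?_
  rw [← toDual_gradient (𝕜 := ℝ) (f := f), InnerProductSpace.toDual_apply_apply,
    EuclideanSpace.inner_single_right]
  simp

lemma lapl_eq_sum_fderiv {n : ℕ} (f : EuclideanSpace ℝ (Fin n) → ℝ)
    (x : EuclideanSpace ℝ (Fin n)) :
    lapl f x = ∑ i, fderiv ℝ (fderiv ℝ f) x (EuclideanSpace.single i 1)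
      (EuclideanSpace.single i 1) := by
  simp [lapl, iteratedFDeriv_two_apply]

lemma continuous_norm_gradient_sq {n : ℕ} {f : EuclideanSpace ℝ (Fin n) → ℝ}
    (hf : ContDiff ℝ 2 f) : Continuous fun x => ‖gradient f x‖ ^ 2 := by
  simp_rw [norm_gradient_sq_eq_sum]
  have := hf.continuous_fderiv two_ne_zero
  fun_prop

lemma continuous_lapl {n : ℕ} {f : EuclideanSpace ℝ (Fin n) → ℝ}
    (hf : ContDiff ℝ 2 f) : Continuous (lapl f) := by
  have h : Continuous (fderiv ℝ (fderiv ℝ f)) :=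
    (hf.fderiv_right (m := 1) (by norm_num)).continuous_fderiv one_ne_zero
  rw [funext (lapl_eq_sum_fderiv f)]
  fun_prop

/-- Integration by parts against the Gaussian weight `exp (-‖x - x₀‖² / c - d)`. -/
lemma integral_gaussian_weight_identity {n : ℕ} (x₀ : EuclideanSpace ℝ (Fin n)) (c d : ℝ)
    {f : EuclideanSpace ℝ (Fin n) → ℝ} (hf : ContDiff ℝ 2 f) (hc : HasCompactSupport f) :
    ∫ x, (2 * ‖gradient f x‖ ^ 2 + 2 * f x * lapl f x
      - f x ^ 2 * (4 * ‖x - x₀‖ ^ 2 / c ^ 2 - 2 * n / c)) * Real.exp (-‖x - x₀‖ ^ 2 / c - d)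
      = 0 := by
  set e : Fin n → EuclideanSpace ℝ (Fin n) := fun i => EuclideanSpace.single i 1 with he
  set G : Fin n → EuclideanSpace ℝ (Fin n) → ℝ := fun i x =>
    (f x * (2 * fderiv ℝ f x (e i) + f x * (2 * (x i - x₀ i) / c)))
      * Real.exp (-‖x - x₀‖ ^ 2 / c - d) with hG
  have hf1 : ContDiff ℝ 1 (fderiv ℝ f) := hf.fderiv_right (by norm_num)
  have hf' : ContDiff ℝ 1 f := hf.of_le (by norm_num)
  have hGs : ∀ i, ContDiff ℝ 1 (G i) := by
    intro i
    have h1 : ContDiff ℝ 1 fun x => fderiv ℝ f x (e i) := hf1.clm_apply contDiff_const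
    have h2 : ContDiff ℝ 1 fun x : EuclideanSpace ℝ (Fin n) => ‖x - x₀‖ ^ 2 :=
      (contDiff_id.sub contDiff_const).norm_sq ℝ
    have h3 : ContDiff ℝ 1 fun x : EuclideanSpace ℝ (Fin n) => x i := by fun_prop
    exact (hf'.mul ((contDiff_const.mul h1).add (hf'.mul
      ((contDiff_const.mul (h3.sub contDiff_const)).div_const c)))).mul
      ((h2.neg.div_const c).sub contDiff_const).exp
  have hGc : ∀ i, HasCompactSupport (G i) := fun i => (hc.mul_right).mul_right
  have hGd : ∀ i x, fderiv ℝ (G i) x (e i) =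
      (2 * fderiv ℝ f x (e i) ^ 2 + 2 * f x * fderiv ℝ (fderiv ℝ f) x (e i) (e i)
      - f x ^ 2 * (4 * (x i - x₀ i) ^ 2 / c ^ 2 - 2 / c)) * Real.exp (-‖x - x₀‖ ^ 2 / c - d) := by
    intro i x
    have k0 : HasFDerivAt f (fderiv ℝ f x) x := (hf'.differentiable one_ne_zero x).hasFDerivAt
    have k1 : HasFDerivAt (fderiv ℝ f) (fderiv ℝ (fderiv ℝ f) x) x :=
      (hf1.differentiable one_ne_zero x).hasFDerivAt
    have kl : HasDerivAt (fun s : ℝ => x + s • e i) (e i) 0 := by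
      simpa using ((hasDerivAt_id (0 : ℝ)).smul_const (e i)).const_add x
    have l0 : HasDerivAt (fun s : ℝ => f (x + s • e i)) (fderiv ℝ f x (e i)) 0 :=
      HasFDerivAt.comp_hasDerivAt (0 : ℝ) (by simpa using k0) kl
    have l1 : HasDerivAt (fun s : ℝ => fderiv ℝ f (x + s • e i) (e i))
        (fderiv ℝ (fderiv ℝ f) x (e i) (e i)) 0 := by
      have := HasFDerivAt.comp_hasDerivAt (0 : ℝ)
        (f := fun s : ℝ => x + s • e i) (by simpa using k1) kl
      simpa using this.clm_apply (hasDerivAt_const (0 : ℝ) (e i))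
    have l2 : HasDerivAt (fun s : ℝ => (x + s • e i) i) 1 0 := by
      have : (fun s : ℝ => (x + s • e i) i) = fun s => x i + s := by
        funext s; simp [he]
      rw [this]
      exact (hasDerivAt_id (0 : ℝ)).const_add (x i)
    have l3 : HasDerivAt (fun s : ℝ => ‖x + s • e i - x₀‖ ^ 2) (2 * (x i - x₀ i)) 0 := by
      have := (kl.sub_const x₀).norm_sq
      simpa [he, EuclideanSpace.inner_single_right] using this
    have l4 := (l0.mul ((l1.const_mul 2).add (l0.mul
      (((l2.sub_const (x₀ i)).const_mul 2).div_const c)))).mul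
      ((l3.neg.div_const c).sub_const d).exp
    have l5 : HasDerivAt (fun s : ℝ => G i (x + s • e i)) (fderiv ℝ (G i) x (e i)) 0 :=
      HasFDerivAt.comp_hasDerivAt (l := G i) (0 : ℝ)
        (by simpa using ((hGs i).differentiable one_ne_zero x).hasFDerivAt) kl
    have := l5.unique l4
    rw [this]
    simp
    ring
  have hsum : ∀ x, (2 * ‖gradient f x‖ ^ 2 + 2 * f x * lapl f x
      - f x ^ 2 * (4 * ‖x - x₀‖ ^ 2 / c ^ 2 - 2 * n / c)) * Real.exp (-‖x - x₀‖ ^ 2 / c - d)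
      = ∑ i, fderiv ℝ (G i) x (e i) := by
    intro x
    simp_rw [hGd]
    rw [← Finset.sum_mul, norm_gradient_sq_eq_sum, lapl_eq_sum_fderiv,
      EuclideanSpace.real_norm_sq_eq (x - x₀)]
    congr 1
    simp only [Finset.sum_sub_distrib, Finset.sum_add_distrib, ← Finset.mul_sum, ← Finset.sum_div,
      Finset.sum_const, Finset.card_univ, Fintype.card_fin, nsmul_eq_mul, PiLp.sub_apply, he]
    ring
  simp_rw [hsum]
  rw [integral_finsetSum]
  · exact Finset.sum_eq_zero fun i _ =>
      integral_fderiv_apply_eq_zero_of_hasCompactSupport volume (hGs i) (hGc i) (e i)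
  · intro i _
    exact (((hGs i).continuous_fderiv one_ne_zero).clm_apply
      continuous_const).integrable_of_hasCompactSupport ((hGc i).fderiv_apply ℝ (e i))

/-- Bound for the defect `∂ₜφ + p(t) (Δφ + |∇φ|²)` of the backward heat-kernel weight, where
`P = p(T)`, `p = p(t)`, `s = T - t + ρ` and `r = |x - x₀|`. -/
lemma abs_heat_weight_defect_le {n p P p₁ M R r s : ℝ} (hp₁ : 0 < p₁) (hP : p₁ ≤ P) (hs : 0 < s)
    (hr : 0 ≤ r) (hrR : r ≤ R) (hn : 0 ≤ n) (hp : |p - P| ≤ M * s) :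
    |(p - P) * (r ^ 2 / (4 * P ^ 2 * s ^ 2) - n / (2 * P * s))| ≤
      M * R ^ 2 / (2 * p₁ ^ 2) / s + (2 + n) * M / p₁ := by
  have hP0 : 0 < P := hp₁.trans_le hP
  have hM : 0 ≤ M := nonneg_of_mul_nonneg_left ((abs_nonneg _).trans hp) hs
  have h1 : |r ^ 2 / (4 * P ^ 2 * s ^ 2) - n / (2 * P * s)| ≤
      R ^ 2 / (2 * p₁ ^ 2 * s ^ 2) + (2 + n) / (p₁ * s) := by
    refine (abs_sub _ _).trans ?_
    rw [abs_of_nonneg (by positivity), abs_of_nonneg (by positivity)]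
    gcongr <;> linarith
  calc |(p - P) * (r ^ 2 / (4 * P ^ 2 * s ^ 2) - n / (2 * P * s))|
      ≤ M * s * (R ^ 2 / (2 * p₁ ^ 2 * s ^ 2) + (2 + n) / (p₁ * s)) := by
        rw [abs_mul]
        exact mul_le_mul hp h1 (abs_nonneg _) (by positivity)
    _ = _ := by
        field_simp

/-- Interior version of Corollary 1(i): the first differential inequality of the logarithmic
convexity method with the explicit backward heat-kernel weight `φ`:
`|y′ + 2Ny| ≤ (C₀/(T−t+ρ) + C₁) y + 2∫|wz|e^φ`, with `C₀ = MR²/(2p₁²)`, `C₁ = (2+n)M/p₁`. -/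
theorem energy_inequality_weighted
    (n : ℕ) (hn : 1 ≤ n) (x₀ : EuclideanSpace ℝ (Fin n))
    (R T ρ p₁ p₂ M : ℝ) (hR : 0 < R) (hT : 0 < T) (hρ : 0 < ρ)
    (ϑ : Set (EuclideanSpace ℝ (Fin n))) (hϑ : IsOpen ϑ) (hϑR : ϑ ⊆ Metric.ball x₀ R)
    (p : ℝ → ℝ) (hp : ContDiff ℝ 1 p)
    (hp₁ : 0 < p₁) (hpbd : ∀ t ∈ Set.Icc (0 : ℝ) T, p₁ ≤ p t ∧ p t ≤ p₂)
    (hp' : ∀ t ∈ Set.Icc (0 : ℝ) T, |deriv p t| ≤ M)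
    (φ : EuclideanSpace ℝ (Fin n) → ℝ → ℝ)
    (hφ : ∀ x t, φ x t =
      -‖x - x₀‖ ^ 2 / (4 * p T * (T - t + ρ)) - (n / 2 : ℝ) * Real.log (T - t + ρ))
    (z : EuclideanSpace ℝ (Fin n) → ℝ → ℝ)
    (hz : ContDiff ℝ (⊤ : ℕ∞) (fun q : EuclideanSpace ℝ (Fin n) × ℝ => z q.1 q.2))
    (K : Set (EuclideanSpace ℝ (Fin n))) (hK : IsCompact K) (hKϑ : K ⊆ ϑ)
    (hsupp : ∀ t ∈ Set.Icc (0 : ℝ) T, Function.support (fun x => z x t) ⊆ K)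
    (w : EuclideanSpace ℝ (Fin n) → ℝ → ℝ)
    (hw : ∀ x t, w x t = deriv (z x) t - p t * lapl (fun y => z y t) x)
    (y N : ℝ → ℝ)
    (hy : ∀ t, y t = ∫ x in ϑ, (z x t) ^ 2 * Real.exp (φ x t))
    (hypos : ∀ t ∈ Set.Icc (0 : ℝ) T, 0 < y t)
    (hN : ∀ t, N t =
      p t * (∫ x in ϑ, ‖gradient (fun x' => z x' t) x‖ ^ 2 * Real.exp (φ x t)) / y t) :
    ∀ t ∈ Set.Ioo (0 : ℝ) T,
      |deriv y t + 2 * N t * y t| ≤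
        (M * R ^ 2 / (2 * p₁ ^ 2) / (T - t + ρ) + (2 + n) * M / p₁) * y t
          + 2 * ∫ x in ϑ, |w x t * z x t| * Real.exp (φ x t) := by
  intro t ht
  have htI : t ∈ Set.Icc (0 : ℝ) T := Set.Ioo_subset_Icc_self ht
  have hTI : T ∈ Set.Icc (0 : ℝ) T := ⟨hT.le, le_rfl⟩
  have hP : 0 < p T := hp₁.trans_le (hpbd T hTI).1
  have hpos : ∀ s ∈ Set.Icc (0 : ℝ) T, 0 < T - s + ρ := fun s hs => by linarith [hs.2]
  have hs := hpos t htI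
  have hz0 : ∀ s ∈ Set.Icc (0 : ℝ) T, ∀ x ∉ K, z x s = 0 := fun s hs x hx => by
    by_contra h
    exact hx (hsupp s hs h)
  have hset : ∀ {g : EuclideanSpace ℝ (Fin n) → ℝ}, (∀ x ∉ K, g x = 0) →
      ∫ x in ϑ, g x = ∫ x, g x := fun h =>
    setIntegral_eq_integral_of_forall_compl_eq_zero fun x hx => h x fun hxK => hx (hKϑ hxK)
  have hKint : ∀ {g : EuclideanSpace ℝ (Fin n) → ℝ}, Continuous g → (∀ x ∉ K, g x = 0) →
      Integrable g := fun hg h =>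
    hg.integrable_of_hasCompactSupport (HasCompactSupport.intro hK h)
  set Z : EuclideanSpace ℝ (Fin n) × ℝ → ℝ := fun q => z q.1 q.2 with hZ
  set zt : EuclideanSpace ℝ (Fin n) → ℝ → ℝ := fun x s => fderiv ℝ Z (x, s) (0, 1) with hzt
  have hztc : Continuous fun q : EuclideanSpace ℝ (Fin n) × ℝ => zt q.1 q.2 :=
    (hz.continuous_fderiv (by simp)).clm_apply continuous_const
  have hzd : ∀ x s, HasDerivAt (z x) (zt x s) s := fun x s =>
    HasFDerivAt.comp_hasDerivAt (l := Z) (f := fun s => (x, s)) s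
      ((hz.differentiable (by simp)) (x, s)).hasFDerivAt
      ((hasDerivAt_const s x).prodMk (hasDerivAt_id s))
  set f : EuclideanSpace ℝ (Fin n) → ℝ := fun x => z x t with hf
  have hf2 : ContDiff ℝ 2 f :=
    (hz.of_le (WithTop.coe_le_coe.2 le_top)).comp (contDiff_id.prodMk contDiff_const)
  have hf0 : ∀ x ∉ K, f x = 0 := hz0 t htI
  have hfc : HasCompactSupport f := HasCompactSupport.intro hK hf0
  have hgrad0 : ∀ x ∉ K, ‖gradient f x‖ ^ 2 = 0 := fun x hx => by
    have : fderiv ℝ f x = 0 := by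
      by_contra h
      exact hx (closure_minimal (hsupp t htI) hK.isClosed (support_fderiv_subset ℝ h))
    simp [norm_gradient_sq_eq_sum, this]
  set φt : EuclideanSpace ℝ (Fin n) → ℝ → ℝ := fun x s =>
    -‖x - x₀‖ ^ 2 / (4 * p T * (T - s + ρ) ^ 2) + n / 2 / (T - s + ρ) with hφt
  have hφd : ∀ x, ∀ s ∈ Set.Icc (0 : ℝ) T, HasDerivAt (φ x) (φt x s) s := by
    intro x s hs
    have h0 := (hpos s hs).ne'
    have h1 : HasDerivAt (fun s => T - s + ρ) (-1) s :=
      ((hasDerivAt_id s).const_sub T).add_const ρ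
    have h2 := ((hasDerivAt_const s (-‖x - x₀‖ ^ 2)).div (h1.const_mul (4 * p T))
      (by positivity)).sub ((h1.log h0).const_mul (n / 2 : ℝ))
    rw [funext (hφ x)]
    refine h2.congr_deriv ?_
    simp only [hφt]
    field_simp
    ring
  have hφc : ∀ s, Continuous fun x => φ x s := fun s => by
    simp_rw [hφ]
    fun_prop
  have hyd : HasDerivAt y
      (∫ x in K, (2 * z x t * zt x t + z x t ^ 2 * φt x t) * Real.exp (φ x t)) t := by
    refine (hK.hasDerivAt_setIntegral (μ := volume)
      (F := fun s x => z x s ^ 2 * Real.exp (φ x s))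
      (F' := fun s x => (2 * z x s * zt x s + z x s ^ 2 * φt x s) * Real.exp (φ x s))
      ht ?_ ?_ ?_).congr_of_eventuallyEq ?_
    · intro s _
      have h1 : Continuous fun x => z x s :=
        hz.continuous.comp (f := fun x => (x, s)) (by fun_prop)
      exact ((h1.pow 2).mul (hφc s).rexp).continuousOn
    · have h1 : Continuous fun q : ℝ × EuclideanSpace ℝ (Fin n) => z q.2 q.1 :=
        hz.continuous.comp continuous_swap
      have h2 : Continuous fun q : ℝ × EuclideanSpace ℝ (Fin n) => zt q.2 q.1 :=
        hztc.comp continuous_swap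
      have h0 : ∀ q ∈ Set.Icc (0 : ℝ) T ×ˢ K, T - q.1 + ρ ≠ 0 :=
        fun q hq => (hpos q.1 hq.1).ne'
      have h0' : ∀ q ∈ Set.Icc (0 : ℝ) T ×ˢ K, 4 * p T * (T - q.1 + ρ) ≠ 0 :=
        fun q hq => mul_ne_zero (by positivity) (h0 q hq)
      have h0'' : ∀ q ∈ Set.Icc (0 : ℝ) T ×ˢ K, 4 * p T * (T - q.1 + ρ) ^ 2 ≠ 0 :=
        fun q hq => mul_ne_zero (by positivity) (pow_ne_zero 2 (h0 q hq))
      have h3 : ContinuousOn (fun q : ℝ × EuclideanSpace ℝ (Fin n) => φ q.2 q.1)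
          (Set.Icc (0 : ℝ) T ×ˢ K) := by
        simp only [hφ]
        fun_prop (disch := assumption)
      have h4 : ContinuousOn (fun q : ℝ × EuclideanSpace ℝ (Fin n) => φt q.2 q.1)
          (Set.Icc (0 : ℝ) T ×ˢ K) := by
        simp only [hφt]
        fun_prop (disch := assumption)
      exact ((((continuous_const.mul h1).mul h2).continuousOn).add
        ((h1.pow 2).continuousOn.mul h4)).mul h3.rexp
    · intro x _ s hs
      refine (((hzd x s).pow 2).mul (hφd x s hs).exp).congr_deriv ?_
      simp
      ring
    · filter_upwards [Icc_mem_nhds ht.1 ht.2] with s hs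
      have h0 : ∀ x ∉ K, z x s ^ 2 * Real.exp (φ x s) = 0 := fun x hx => by
        simp [hz0 s hs x hx]
      rw [hy, hset h0, setIntegral_eq_integral_of_forall_compl_eq_zero h0]
  have hwt : ∀ x, w x t = zt x t - p t * lapl f x := fun x => by rw [hw, (hzd x t).deriv]
  set E : EuclideanSpace ℝ (Fin n) → ℝ := fun x => Real.exp (φ x t) with hE
  have hEc : Continuous E := (hφc t).rexp
  have hfcont : Continuous f := hf2.continuous
  have hwc : Continuous fun x => w x t := by
    simp_rw [hwt]
    have h1 : Continuous fun x => zt x t := hztc.comp (f := fun x => (x, t)) (by fun_prop)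
    exact h1.sub (continuous_const.mul (continuous_lapl hf2))
  have hφtc : Continuous fun x => φt x t := by
    simp only [hφt]
    fun_prop
  set c : ℝ := 4 * p T * (T - t + ρ) with hcdef
  set q : EuclideanSpace ℝ (Fin n) → ℝ := fun x => 4 * ‖x - x₀‖ ^ 2 / c ^ 2 - 2 * n / c with hq
  have hqc : Continuous q := by fun_prop
  have hdiv : ∫ x, (2 * ‖gradient f x‖ ^ 2 + 2 * f x * lapl f x - f x ^ 2 * q x) * E x = 0 := by
    simp only [hE, hφ]
    exact integral_gaussian_weight_identity x₀ c _ hf2 hfc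
  have hgi : Integrable fun x => ‖gradient f x‖ ^ 2 * E x :=
    hKint ((continuous_norm_gradient_sq hf2).mul hEc) fun x hx => by rw [hgrad0 x hx, zero_mul]
  have hdi : Integrable fun x =>
      (2 * ‖gradient f x‖ ^ 2 + 2 * f x * lapl f x - f x ^ 2 * q x) * E x := by
    refine hKint ?_ fun x hx => by rw [hgrad0 x hx, hf0 x hx]; ring
    have h1 := continuous_norm_gradient_sq hf2
    have h2 := continuous_lapl hf2
    fun_prop
  set Q : EuclideanSpace ℝ (Fin n) → ℝ := fun x => φt x t + p t * q x with hQ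
  have hri : Integrable fun x => (2 * (w x t * f x) + f x ^ 2 * Q x) * E x :=
    hKint (by fun_prop) fun x hx => by rw [hf0 x hx]; ring
  have hwi : Integrable fun x => |w x t * f x| * E x :=
    hKint (by fun_prop) fun x hx => by rw [hf0 x hx]; simp
  have hfi : Integrable fun x => f x ^ 2 * E x :=
    hKint (by fun_prop) fun x hx => by rw [hf0 x hx]; ring
  have hyderiv : deriv y t + 2 * (p t * ∫ x, ‖gradient f x‖ ^ 2 * E x)
      = ∫ x, (2 * (w x t * f x) + f x ^ 2 * Q x) * E x := by
    have h1 : ∀ x, (2 * z x t * zt x t + z x t ^ 2 * φt x t) * Real.exp (φ x t)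
        = (2 * (w x t * f x) + f x ^ 2 * Q x) * E x
          - 2 * p t * (‖gradient f x‖ ^ 2 * E x)
          + p t * ((2 * ‖gradient f x‖ ^ 2 + 2 * f x * lapl f x - f x ^ 2 * q x) * E x) := by
      intro x
      rw [hwt]
      simp only [hQ, hf, hE]
      ring
    rw [hyd.deriv, setIntegral_eq_integral_of_forall_compl_eq_zero fun x hx => by
      rw [hz0 t htI x hx]; ring]
    simp_rw [h1]
    have h2 := integral_add (hri.sub (hgi.const_mul (2 * p t))) (hdi.const_mul (p t))
    simp only [Pi.sub_apply] at h2
    rw [h2, integral_sub hri (hgi.const_mul _), integral_const_mul, integral_const_mul, hdiv]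
    ring
  have hNy : 2 * N t * y t = 2 * (p t * ∫ x, ‖gradient f x‖ ^ 2 * E x) := by
    rw [hN, hset fun x hx => by rw [hgrad0 x hx, zero_mul]]
    rw [mul_assoc, div_mul_cancel₀ _ (hypos t htI).ne']
  have hyt : y t = ∫ x, f x ^ 2 * E x := by
    rw [hy, hset fun x hx => by rw [hz0 t htI x hx]; ring]
  have hpdiff : |p t - p T| ≤ M * (T - t + ρ) := by
    have h1 := (convex_Icc (0 : ℝ) T).norm_image_sub_le_of_norm_deriv_le
      (fun s _ => hp.differentiable one_ne_zero s) hp' hTI htI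
    have h2 : ‖t - T‖ = T - t := by
      rw [Real.norm_eq_abs, abs_sub_comm, abs_of_nonneg (by linarith [ht.2])]
    rw [h2] at h1
    have hM : 0 ≤ M := (abs_nonneg _).trans (hp' t htI)
    exact h1.trans (mul_le_mul_of_nonneg_left (by linarith) hM)
  have hQb : ∀ x ∈ K, |Q x| ≤ M * R ^ 2 / (2 * p₁ ^ 2) / (T - t + ρ) + (2 + n) * M / p₁ := by
    intro x hx
    have hxR : ‖x - x₀‖ ≤ R := by
      have := hϑR (hKϑ hx)
      rw [Metric.mem_ball, dist_eq_norm] at this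
      exact this.le
    have := abs_heat_weight_defect_le (n := n) hp₁ (hpbd T hTI).1 hs (norm_nonneg _) hxR
      n.cast_nonneg hpdiff
    refine le_of_eq_of_le (congrArg abs ?_) this
    simp only [hQ, hq, hφt, hcdef]
    field_simp
    ring
  rw [hNy, hyderiv, hyt, hset fun x hx => by rw [hz0 t htI x hx]; simp]
  rw [← integral_const_mul, ← integral_const_mul, ← integral_add (hfi.const_mul _)
    (hwi.const_mul _)]
  refine abs_integral_le_integral_abs.trans (integral_mono hri.abs
    ((hfi.const_mul _).add (hwi.const_mul _)) fun x => ?_)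
  have hEp : 0 < E x := Real.exp_pos _
  by_cases hx : x ∈ K
  · have h1 : |2 * (w x t * f x) + f x ^ 2 * Q x| ≤ 2 * |w x t * f x| + f x ^ 2 *
        (M * R ^ 2 / (2 * p₁ ^ 2) / (T - t + ρ) + (2 + n) * M / p₁) := by
      refine (abs_add_le _ _).trans ?_
      rw [abs_mul, abs_mul (f x ^ 2), abs_two, abs_of_nonneg (sq_nonneg (f x))]
      gcongr
      exact hQb x hx
    calc |(2 * (w x t * f x) + f x ^ 2 * Q x) * E x|
        = |2 * (w x t * f x) + f x ^ 2 * Q x| * E x := by rw [abs_mul, abs_of_pos hEp]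
      _ ≤ _ := mul_le_mul_of_nonneg_right h1 hEp.le
      _ = _ := by ring
  · simp [hf0 x hx]
end

section
/- Let T > 0, ρ > 0, C₁ ≥ 0 and ℓ > 1 with ℓρ ≤ min{1/2, T/4}. Then ( ∫_{T−ℓρ}^{T} e^{C₁ s}/(T − s + ρ) ds ) / ( ∫_{T−2ℓρ}^{T−ℓρ} e^{C₁ s}/(T − s + ρ) ds ) ≤ e^{C₁} · ln(1+ℓ)/ln(3/2). -/
theorem integral_inv_sub_add {T ρ a b : ℝ} (hab : a ≤ b) (hb : b < T + ρ) :
    ∫ s in a..b, (T - s + ρ)⁻¹ = Real.log ((T - a + ρ) / (T - b + ρ)) := by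
  have h := intervalIntegral.integral_comp_sub_left (fun x : ℝ => x⁻¹) (T + ρ) (a := a) (b := b)
  rw [integral_inv_of_pos (by linarith) (by linarith)] at h
  simpa only [add_sub_right_comm] using h

theorem continuousOn_inv_sub_add {T ρ a b : ℝ} (hb : b < T + ρ) :
    ContinuousOn (fun s : ℝ => (T - s + ρ)⁻¹) (Set.Icc a b) :=
  ContinuousOn.inv₀ (by fun_prop) fun s hs => by linarith [hs.2]

theorem intervalIntegrable_exp_div_sub_add {T ρ a b : ℝ} (C : ℝ) (hab : a ≤ b)
    (hb : b < T + ρ) :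
    IntervalIntegrable (fun s : ℝ => Real.exp (C * s) / (T - s + ρ)) MeasureTheory.volume a b := by
  refine ContinuousOn.intervalIntegrable_of_Icc hab ?_
  simp only [div_eq_mul_inv]
  exact ContinuousOn.mul (by fun_prop) (continuousOn_inv_sub_add hb)

theorem integral_exp_div_sub_add_le {T ρ C a b : ℝ} (hC : 0 ≤ C) (hab : a ≤ b)
    (hb : b < T + ρ) :
    ∫ s in a..b, Real.exp (C * s) / (T - s + ρ) ≤
      Real.exp (C * b) * Real.log ((T - a + ρ) / (T - b + ρ)) := by
  rw [← integral_inv_sub_add hab hb, ← intervalIntegral.integral_const_mul]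
  refine intervalIntegral.integral_mono_on hab (intervalIntegrable_exp_div_sub_add C hab hb)
    (((continuousOn_inv_sub_add hb).intervalIntegrable_of_Icc hab).const_mul _) fun s hs => ?_
  have hpos : 0 < T - s + ρ := by linarith [hs.2]
  rw [div_eq_mul_inv]
  gcongr
  exact hs.2

theorem le_integral_exp_div_sub_add {T ρ C a b : ℝ} (hC : 0 ≤ C) (hab : a ≤ b)
    (hb : b < T + ρ) :
    Real.exp (C * a) * Real.log ((T - a + ρ) / (T - b + ρ)) ≤
      ∫ s in a..b, Real.exp (C * s) / (T - s + ρ) := by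
  rw [← integral_inv_sub_add hab hb, ← intervalIntegral.integral_const_mul]
  refine intervalIntegral.integral_mono_on hab
    (((continuousOn_inv_sub_add hb).intervalIntegrable_of_Icc hab).const_mul _)
    (intervalIntegrable_exp_div_sub_add C hab hb) fun s hs => ?_
  have hpos : 0 < T - s + ρ := by linarith [hs.2]
  rw [div_eq_mul_inv]
  gcongr
  exact hs.1

/-- Integral ratio estimate bounding the interpolation exponent `M_ℓ` in the case `C₀ = 0`. -/
theorem integral_ratio_C0_zero
    (T ρ C₁ ℓ : ℝ) (hT : 0 < T) (hρ : 0 < ρ) (hC₁ : 0 ≤ C₁)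
    (hℓ : 1 < ℓ) (hℓρ : ℓ * ρ ≤ min (1 / 2) (T / 4)) :
    (∫ s in (T - ℓ * ρ)..T, Real.exp (C₁ * s) / (T - s + ρ)) /
      (∫ s in (T - 2 * ℓ * ρ)..(T - ℓ * ρ), Real.exp (C₁ * s) / (T - s + ρ)) ≤
    Real.exp C₁ * Real.log (1 + ℓ) / Real.log (3 / 2) := by
  have hpos : 0 < ℓ * ρ := by positivity
  have hhalf : ℓ * ρ ≤ 1 / 2 := hℓρ.trans (min_le_left _ _)
  have hlog : 0 < Real.log (3 / 2) := Real.log_pos (by norm_num)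
  have hlogℓ : 0 < Real.log (1 + ℓ) := Real.log_pos (by linarith)
  have hnum := integral_exp_div_sub_add_le (T := T) (ρ := ρ) (a := T - ℓ * ρ) (b := T) hC₁
    (by linarith) (by linarith)
  have hden := le_integral_exp_div_sub_add (T := T) (ρ := ρ) (a := T - 2 * ℓ * ρ)
    (b := T - ℓ * ρ) hC₁ (by linarith) (by linarith)
  rw [show (T - (T - ℓ * ρ) + ρ) / (T - T + ρ) = 1 + ℓ by field_simp; ring] at hnum
  have hratio : 3 / 2 ≤ (T - (T - 2 * ℓ * ρ) + ρ) / (T - (T - ℓ * ρ) + ρ) := by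
    rw [le_div_iff₀ (by linarith)]
    nlinarith
  have hden' : Real.exp (C₁ * (T - 2 * ℓ * ρ)) * Real.log (3 / 2) ≤ _ :=
    (mul_le_mul_of_nonneg_left (Real.log_le_log (by norm_num) hratio) (Real.exp_pos _).le).trans
      hden
  have hexp : Real.exp (C₁ * T) ≤ Real.exp C₁ * Real.exp (C₁ * (T - 2 * ℓ * ρ)) := by
    rw [← Real.exp_add, Real.exp_le_exp]
    nlinarith
  calc _ ≤ Real.exp (C₁ * T) * Real.log (1 + ℓ) /
        (Real.exp (C₁ * (T - 2 * ℓ * ρ)) * Real.log (3 / 2)) := by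
        gcongr
    _ ≤ Real.exp C₁ * Real.exp (C₁ * (T - 2 * ℓ * ρ)) * Real.log (1 + ℓ) /
        (Real.exp (C₁ * (T - 2 * ℓ * ρ)) * Real.log (3 / 2)) := by gcongr
    _ = Real.exp C₁ * Real.log (1 + ℓ) / Real.log (3 / 2) := by field_simp
end
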